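/- Let e₁, e₂ be projections in a finite von Neumann algebra and f a projection with f ≤ e₁ ∨ e₂. Then f ≤ E₁♯(f) ∨ E₂♯(f) ∨ (e₁∧e₂ − (1−f)∧e₁∧e₂), where Eᵢ = E(eᵢ, e_{i'}) are the complementary idempotents associated to e₁ and e₂. -/

import Mathlib

open scoped ComplexOrder

namespace Paper

variable {H : Type} [NormedAddCommGroup H] [InnerProductSpace ℂ H] [CompleteSpace H]

/-- `p` is an (orthogonal) projection operator. -/
def IsProj (p : H →L[ℂ] H) : Prop := IsIdempotentElem p ∧ IsSelfAdjoint p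

/-- `p` is a projection belonging to the von Neumann algebra `M`. -/
def IsProjection (M : VonNeumannAlgebra H) (p : H →L[ℂ] H) : Prop :=
  p ∈ M ∧ IsProj p

/-- The range of an operator, as a submodule. -/
def rng (p : H →L[ℂ] H) : Submodule ℂ H := LinearMap.range p.toLinearMap

/-- `r` is the lattice meet `p ∧ q` of projections: the orthogonal projection onto `pH ∩ qH`. -/
def IsMeetOf (r p q : H →L[ℂ] H) : Prop := IsProj r ∧ rng r = rng p ⊓ rng q

/-- `r` is the lattice join `p ∨ q` of projections:
the orthogonal projection onto the closure of `pH + qH`. -/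
def IsJoinOf (r p q : H →L[ℂ] H) : Prop :=
  IsProj r ∧ rng r = (rng p ⊔ rng q).topologicalClosure

/-- A faithful tracial state on a von Neumann algebra, making it a finite von Neumann algebra. -/
structure TracialState (M : VonNeumannAlgebra H) where
  τ : (H →L[ℂ] H) → ℂ
  map_add : ∀ a b : H →L[ℂ] H, τ (a + b) = τ a + τ b
  map_smul : ∀ (c : ℂ) (a : H →L[ℂ] H), τ (c • a) = c * τ a
  tracial : ∀ a b : H →L[ℂ] H, a ∈ M → b ∈ M → τ (a * b) = τ (b * a)
  pos : ∀ a : H →L[ℂ] H, a ∈ M → 0 ≤ τ (star a * a)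
  faithful : ∀ a : H →L[ℂ] H, a ∈ M → τ (star a * a) = 0 → a = 0
  normalized : τ 1 = 1

/-- `M` is diffuse: it has no minimal nonzero projections. -/
def Diffuse (M : VonNeumannAlgebra H) : Prop :=
  ∀ p : H →L[ℂ] H, IsProjection M p → p ≠ 0 →
    ∃ q : H →L[ℂ] H, IsProjection M q ∧ rng q ≤ rng p ∧ q ≠ 0 ∧ q ≠ p

end Paper

namespace Paper

variable {H : Type} [NormedAddCommGroup H] [InnerProductSpace ℂ H] [CompleteSpace H]

/-- A closed densely defined operator `X` (given as a partially defined linear map) is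
affiliated with `M` if every unitary in the commutant of `M` leaves its domain invariant and
commutes with it. -/
def Affiliated (M : VonNeumannAlgebra H) (X : H →ₗ.[ℂ] H) : Prop :=
  Dense (X.domain : Set H) ∧ IsClosed (X.graph : Set (H × H)) ∧
    ∀ u : H →L[ℂ] H, u ∈ M.commutant → u * star u = 1 → star u * u = 1 →
      ∀ x : X.domain, ∃ h : u (x : H) ∈ X.domain, X ⟨u (x : H), h⟩ = u (X x)

/-- The kernel of a partially defined operator, as a subset of `H`. -/
def kernelSet (X : H →ₗ.[ℂ] H) : Set H := {x | ∃ h : x ∈ X.domain, X ⟨x, h⟩ = 0}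

/-- The image of a set `S` under a partially defined operator. -/
def imageSet (X : H →ₗ.[ℂ] H) (S : Set H) : Set H :=
  {y | ∃ x : X.domain, (x : H) ∈ S ∧ X x = y}

/-- `k` is the kernel projection of `X`: the projection onto `ker X`. -/
def IsKerProj (X : H →ₗ.[ℂ] H) (k : H →L[ℂ] H) : Prop :=
  IsProj k ∧ (rng k : Set H) = kernelSet X

/-- `R` is the range projection of `X`: the projection onto the closure of `ran X`. -/
def IsRanProj (X : H →ₗ.[ℂ] H) (R : H →L[ℂ] H) : Prop :=
  IsProj R ∧ (rng R : Set H) = closure (imageSet X Set.univ)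

/-- `q = X♯(p)`: `q` is the range projection of `Xp`, i.e. the projection onto the closure
of `X(pH ∩ dom X)`. -/
def IsSharp (X : H →ₗ.[ℂ] H) (p q : H →L[ℂ] H) : Prop :=
  IsProj q ∧ (rng q : Set H) = closure (imageSet X (rng p : Set H))

end Paper

namespace Paper

variable {H : Type} [NormedAddCommGroup H] [InnerProductSpace ℂ H] [CompleteSpace H]

/-- `E` is the complementary idempotent `E(e₁,e₂)` of the projections `e₁, e₂`, where `j` is
the join `e₁ ∨ e₂` and `m` is the meet `e₁ ∧ e₂`: `E` has domain
`(1 − e₁∨e₂)H + e₁H + e₂H` and sends `η + ξ₁ + ξ₂ + ζ ↦ ξ₁ + ζ` for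
`η ∈ (1 − e₁∨e₂)H`, `ξᵢ ∈ (eᵢ − e₁∧e₂)H`, `ζ ∈ (e₁∧e₂)H`. -/
def IsComplIdem (e₁ e₂ j m : H →L[ℂ] H) (E : H →ₗ.[ℂ] H) : Prop :=
  E.domain = rng (1 - j) ⊔ rng e₁ ⊔ rng e₂ ∧
    ∀ η ξ₁ ξ₂ ζ : H, η ∈ rng (1 - j) → ξ₁ ∈ rng (e₁ - m) → ξ₂ ∈ rng (e₂ - m) → ζ ∈ rng m →
      ∃ h : η + ξ₁ + ξ₂ + ζ ∈ E.domain, E ⟨η + ξ₁ + ξ₂ + ζ, h⟩ = ξ₁ + ζ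

end Paper

namespace Paper

open ContinuousLinearMap

variable {H : Type} [NormedAddCommGroup H] [InnerProductSpace ℂ H] [CompleteSpace H]

lemma IsProj.mem_rng_iff {p : H →L[ℂ] H} (hp : IsProj p) {x : H} : x ∈ rng p ↔ p x = x := by
  refine ⟨?_, fun h => ⟨x, h⟩⟩
  rintro ⟨y, rfl⟩
  exact congr($(hp.1) y)

lemma IsProj.inner_left {p : H →L[ℂ] H} (hp : IsProj p) (x y : H) :
    inner ℂ (p x) y = inner ℂ x (p y) := by
  conv_lhs => rw [← hp.2.adjoint_eq]
  exact adjoint_inner_left p y x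

lemma IsProj.one_sub {p : H →L[ℂ] H} (hp : IsProj p) : IsProj (1 - p) :=
  ⟨hp.1.one_sub, (IsSelfAdjoint.one _).sub hp.2⟩

/-- The orthogonal projection onto the kernel of an element of `M` belongs to `M`. -/
lemma IsProj.mem_of_rng_eq_ker {M : VonNeumannAlgebra H} {a : H →L[ℂ] H} (ha : a ∈ M)
    {p : H →L[ℂ] H} (hp : IsProj p) (hker : ∀ x, p x = x ↔ a x = 0) : p ∈ M := by
  refine (VonNeumannAlgebra.IsStarProjection.mem_iff ⟨hp.1, hp.2⟩ M).2 fun y hy x hx => ?_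
  have hay : a (y x) = y (a x) := congr($(VonNeumannAlgebra.mem_commutant_iff.1 hy a ha) x)
  refine hp.mem_rng_iff.2 ((hker _).2 ?_)
  change a (y x) = 0
  rw [hay, (hker x).1 (hp.mem_rng_iff.1 hx), map_zero]

/-- An isometry in a finite von Neumann algebra is unitary. -/
lemma TracialState.mul_star_self_eq_one {M : VonNeumannAlgebra H} (T : TracialState M)
    {u : H →L[ℂ] H} (hu : u ∈ M) (h : star u * u = 1) : u * star u = 1 := by
  have hM : 1 - u * star u ∈ M := sub_mem (one_mem M) (mul_mem hu (star_mem hu))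
  have hidem : star (1 - u * star u) * (1 - u * star u) = 1 - u * star u := by
    have : u * star u * (u * star u) = u * star u := by
      rw [mul_assoc, ← mul_assoc (star u), h, one_mul]
    simp [mul_sub, sub_mul, this]
  have hτ : T.τ (1 - u * star u) = 0 := by
    have h1 := T.map_add (1 - u * star u) (u * star u)
    rw [sub_add_cancel, T.tracial u (star u) hu (star_mem hu), h] at h1
    simpa using h1
  exact (sub_eq_zero.1 (T.faithful _ hM (by rw [hidem, hτ]))).symm

/-- An injective element of a von Neumann algebra factors as an isometry in the algebra times
its absolute value. -/
lemma exists_isometry_mul_abs {M : VonNeumannAlgebra H} {d : H →L[ℂ] H} (hd : d ∈ M)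
    (hinj : ∀ x, d x = 0 → x = 0) :
    ∃ u ∈ M, star u * u = 1 ∧ u * CFC.abs d = d := by
  set a := CFC.abs d
  have hsa : star a = a := (CFC.abs_nonneg d).isSelfAdjoint
  have hsq : star a * a = star d * d := by rw [hsa]; exact CFC.abs_mul_abs d
  have hnorm (x : H) : ‖d x‖ = ‖a x‖ := by
    have h1 := apply_norm_eq_sqrt_inner_adjoint_left d x
    have h2 := apply_norm_eq_sqrt_inner_adjoint_left a x
    rw [h1, h2]
    exact congr(√(RCLike.re (inner ℂ ($(hsq.symm) x) x)))
  have hdense : DenseRange a := by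
    have : (LinearMap.range a.toLinearMap)ᗮ = ⊥ := by
      refine (Submodule.eq_bot_iff _).2 fun x hx => hinj x ?_
      rw [← norm_eq_zero, hnorm, norm_eq_zero, ← inner_self_eq_zero (𝕜 := ℂ)]
      have := (Submodule.mem_orthogonal _ _).1 hx (a (a x)) ⟨a x, rfl⟩
      rwa [← adjoint_inner_left, ← star_eq_adjoint, hsa]
    have h2 := (Submodule.topologicalClosure_eq_top_iff).2 this
    exact (Submodule.dense_iff_topologicalClosure_eq_top).2 h2
  have hbound : ∀ x, ‖d.toLinearMap x‖ ≤ 1 * ‖a.toLinearMap x‖ := fun x => by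
    simpa using (hnorm x).le
  set u : H →L[ℂ] H := d.toLinearMap.extendOfNorm a.toLinearMap
  have hua (x : H) : u (a x) = d x := LinearMap.extendOfNorm_eq hdense ⟨1, hbound⟩ x
  refine ⟨u, ?_, ?_, ContinuousLinearMap.ext hua⟩
  · rw [← VonNeumannAlgebra.commutant_commutant M, VonNeumannAlgebra.mem_commutant_iff]
    intro t ht
    have h1 : Commute d t := VonNeumannAlgebra.mem_commutant_iff.1 ht d hd
    have h2 : Commute d (star t) := VonNeumannAlgebra.mem_commutant_iff.1 (star_mem ht) d hd
    have h3 : Commute a t := h1.cfcAbs_left h2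
    refine ContinuousLinearMap.ext (congr_fun (hdense.equalizer (by fun_prop) (by fun_prop) ?_))
    funext x
    have h4 : a (t x) = t (a x) := congr($(h3.eq) x)
    have h5 : d (t x) = t (d x) := congr($(h1.eq) x)
    simp [hua, ← h4, h5]
  · refine (norm_map_iff_adjoint_comp_self u).1 (congr_fun
      (hdense.equalizer (by fun_prop) (by fun_prop) ?_))
    funext x
    simp [hua, hnorm]

/-- In a finite von Neumann algebra, the adjoint of an injective element is injective. -/
lemma TracialState.star_injective {M : VonNeumannAlgebra H} (T : TracialState M)
    {d : H →L[ℂ] H} (hd : d ∈ M) (hinj : ∀ x, d x = 0 → x = 0) (v : H)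
    (hv : star d v = 0) : v = 0 := by
  obtain ⟨u, hu, huu, hd'⟩ := exists_isometry_mul_abs hd hinj
  have h1 : CFC.abs d (star u v) = 0 := by
    rw [← hd', star_mul, (CFC.abs_nonneg d).isSelfAdjoint.star_eq] at hv
    exact hv
  have h2 : star u v = 0 := hinj _ (by rw [← hd']; simp [h1])
  have h3 : u (star u v) = v := congr($(T.mul_star_self_eq_one hu huu) v)
  rw [← h3, h2, map_zero]

/-- In a finite von Neumann algebra, the range of a projection meets the range of an injective
element in a dense subspace. -/
lemma TracialState.rng_le_closure_inf_rng {M : VonNeumannAlgebra H} (T : TracialState M)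
    {b f : H →L[ℂ] H} (hb : b ∈ M) (hinj : ∀ x, b x = 0 → x = 0) (hf : IsProjection M f) :
    rng f ≤ (rng f ⊓ rng b).topologicalClosure := by
  set K := (rng f ⊓ rng b).topologicalClosure
  have hcM : (1 - f) * b ∈ M := mul_mem (sub_mem (one_mem M) hf.1) hb
  set N := LinearMap.ker ((1 - f) * b).toLinearMap
  have hNc : IsClosed (N : Set H) := ContinuousLinearMap.isClosed_ker ((1 - f) * b)
  have : CompleteSpace N := hNc.completeSpace_coe
  set n := N.starProjection
  have hn : IsProj n := ⟨N.isIdempotentElem_starProjection, isSelfAdjoint_starProjection N⟩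
  have hmemN (x : H) : x ∈ N ↔ f (b x) = b x := by
    change b x - f (b x) = 0 ↔ _
    rw [sub_eq_zero, eq_comm]
  have hnM : n ∈ M := IsProj.mem_of_rng_eq_ker hcM hn fun x =>
    Submodule.starProjection_eq_self_iff
  have hdM : (1 - f) * b + b * n ∈ M := add_mem hcM (mul_mem hb hnM)
  have hbn (x : H) : f (b (n x)) = b (n x) :=
    (hmemN _).1 (N.starProjection_apply_mem x)
  have hff (y : H) : f (f y) = f y := congr($(hf.2.1) y)
  have hdinj (x : H) (hx : ((1 - f) * b + b * n) x = 0) : x = 0 := by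
    have hx' : b x - f (b x) + b (n x) = 0 := by simpa using hx
    have h1 : b (n x) = 0 := by simpa [hff, hbn] using congr(f $hx')
    have h2 : n x = x := Submodule.starProjection_eq_self_iff.2 <| (hmemN x).2 <| by
      rw [h1, add_zero, sub_eq_zero] at hx'
      exact hx'.symm
    exact hinj x (h2 ▸ h1)
  intro v hv
  have : CompleteSpace K := (Submodule.isClosed_topologicalClosure _).completeSpace_coe
  obtain ⟨k, hk, w, hw, rfl⟩ := K.exists_add_mem_mem_orthogonal v
  have hKf : K ≤ rng f := Submodule.topologicalClosure_minimal _ inf_le_left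
    (hf.2.1.isClosed_range)
  have hwf : f w = w := hf.2.mem_rng_iff.1 (by simpa using sub_mem hv (hKf hk))
  suffices w = 0 by simpa [this] using hk
  refine T.star_injective hdM hdinj w (ext_inner_left ℂ fun x => ?_)
  rw [star_eq_adjoint, adjoint_inner_right, inner_zero_right]
  have h1 : inner ℂ (b (n x)) w = 0 := (Submodule.mem_orthogonal _ _).1 hw _ <|
    Submodule.le_topologicalClosure _ ⟨⟨_, hbn x⟩, ⟨_, rfl⟩⟩
  have h2 : inner ℂ (f (b x)) w = inner ℂ (b x) w := by rw [hf.2.inner_left, hwf]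
  simp [inner_add_left, inner_sub_left, h1, h2]

/-- The complement of the join of two projections is the kernel of their sum. -/
lemma IsJoinOf.one_sub_apply_eq_self_iff {e₁ e₂ j : H →L[ℂ] H} (he₁ : IsProj e₁)
    (he₂ : IsProj e₂) (hj : IsJoinOf j e₁ e₂) (x : H) :
    (1 - j) x = x ↔ (e₁ + e₂) x = 0 := by
  have hle : rng e₁ ⊔ rng e₂ ≤ rng j := hj.2 ▸ Submodule.le_topologicalClosure _
  have hje (e : H →L[ℂ] H) (he : IsProj e) (hle : rng e ≤ rng j) (y : H) : e (j y) = e y := by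
    refine ext_inner_right ℂ fun z => ?_
    have h : j (e z) = e z := hj.1.mem_rng_iff.1 (hle ⟨z, rfl⟩)
    rw [he.inner_left, hj.1.inner_left, h, he.inner_left]
  have hne (e : H →L[ℂ] H) (he : IsProj e) : inner ℂ (e x) x = (‖e x‖ : ℂ) ^ 2 := by
    have h : e (e x) = e x := he.mem_rng_iff.1 ⟨x, rfl⟩
    refine Eq.trans ?_ (inner_self_eq_norm_sq_to_K (𝕜 := ℂ) (e x))
    rw [he.inner_left x (e x), h, he.inner_left]
  have hsub : (1 - j) x = x ↔ j x = 0 := by simp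
  rw [hsub]
  constructor
  · intro h
    have h1 := hje e₁ he₁ (le_sup_left.trans hle) x
    have h2 := hje e₂ he₂ (le_sup_right.trans hle) x
    rw [h, map_zero] at h1 h2
    simp [← h1, ← h2]
  · intro h
    have h0 : (‖e₁ x‖ : ℂ) ^ 2 + (‖e₂ x‖ : ℂ) ^ 2 = 0 := by
      rw [← hne e₁ he₁, ← hne e₂ he₂, ← inner_add_left]
      exact (congrArg (inner ℂ · x) h).trans (inner_zero_left x)
    have h0' : ‖e₁ x‖ ^ 2 + ‖e₂ x‖ ^ 2 = 0 := by exact_mod_cast h0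
    have h1 : e₁ x = 0 := by
      rw [← norm_eq_zero]; nlinarith [sq_nonneg ‖e₁ x‖, sq_nonneg ‖e₂ x‖]
    have h2 : e₂ x = 0 := by simpa [h1] using h
    have hperp : rng j ≤ (ℂ ∙ x)ᗮ := by
      rw [hj.2]
      refine Submodule.topologicalClosure_minimal _ (sup_le ?_ ?_)
        (Submodule.isClosed_orthogonal _)
      · rintro _ ⟨y, rfl⟩
        refine Submodule.mem_orthogonal_singleton_iff_inner_left.2 ?_
        exact (he₁.inner_left y x).trans (by simp [h1])
      · rintro _ ⟨y, rfl⟩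
        refine Submodule.mem_orthogonal_singleton_iff_inner_left.2 ?_
        exact (he₂.inner_left y x).trans (by simp [h2])
    have h3 := Submodule.mem_orthogonal_singleton_iff_inner_left.1 (hperp ⟨j x, rfl⟩)
    rw [← inner_self_eq_zero (𝕜 := ℂ), ← hj.1.inner_left]
    exact h3

/-- The range of a projection meets the domain of a complementary idempotent in a dense
subspace. -/
lemma TracialState.rng_le_closure_inf_sup {M : VonNeumannAlgebra H} (T : TracialState M)
    {e₁ e₂ j f : H →L[ℂ] H} (he₁ : IsProjection M e₁) (he₂ : IsProjection M e₂)
    (hj : IsJoinOf j e₁ e₂) (hf : IsProjection M f) :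
    rng f ≤ (rng f ⊓ (rng (1 - j) ⊔ rng e₁ ⊔ rng e₂)).topologicalClosure := by
  have hker := hj.one_sub_apply_eq_self_iff he₁.2 he₂.2
  have hjM : 1 - j ∈ M := IsProj.mem_of_rng_eq_ker (add_mem he₁.1 he₂.1) hj.1.one_sub hker
  have hle : rng e₁ ⊔ rng e₂ ≤ rng j := hj.2 ▸ Submodule.le_topologicalClosure _
  refine (T.rng_le_closure_inf_rng (b := (1 - j) + (e₁ + e₂))
    (add_mem hjM (add_mem he₁.1 he₂.1)) (fun x hx => ?_) hf).trans
    (Submodule.topologicalClosure_mono (inf_le_inf_left _ ?_))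
  · have hx' : (1 - j) x + (e₁ + e₂) x = 0 := hx
    have h1 : (1 - j) ((1 - j) x) = (1 - j) x := congr($(hj.1.one_sub.1) x)
    have h2 : (1 - j) ((e₁ + e₂) x) = 0 := by
      have : j ((e₁ + e₂) x) = (e₁ + e₂) x := hj.1.mem_rng_iff.1 <| hle <|
        Submodule.add_mem_sup ⟨x, rfl⟩ ⟨x, rfl⟩
      exact sub_eq_zero.2 this.symm
    have h3 : (1 - j) x = 0 := by
      have := congrArg (1 - j : H →L[ℂ] H) hx'
      rwa [_root_.map_add, h1, h2, add_zero, map_zero] at this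
    rw [h3, zero_add] at hx'
    rw [← (hker x).2 hx', h3]
  · rintro _ ⟨x, rfl⟩
    rw [sup_assoc]
    exact Submodule.add_mem_sup ⟨x, rfl⟩ (Submodule.add_mem_sup ⟨x, rfl⟩ ⟨x, rfl⟩)

end Paper

/-- Let `e₁, e₂` be projections in a finite von Neumann algebra and `f` a projection with
`f ≤ e₁ ∨ e₂`.  Then `f ≤ E₁♯(f) ∨ E₂♯(f) ∨ (e₁∧e₂ − (1−f)∧e₁∧e₂)`, where
`E₁ = E(e₁,e₂)`, `E₂ = E(e₂,e₁)` are the complementary idempotents associated to `e₁, e₂`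
and `Eᵢ♯(f)` is the range projection of `Eᵢ f`. -/
theorem le_sharp_join {H : Type} [NormedAddCommGroup H] [InnerProductSpace ℂ H]
    [CompleteSpace H] (M : VonNeumannAlgebra H) (T : Paper.TracialState M)
    (e₁ e₂ j m : H →L[ℂ] H)
    (he₁ : Paper.IsProjection M e₁) (he₂ : Paper.IsProjection M e₂)
    (hj : Paper.IsJoinOf j e₁ e₂) (hm : Paper.IsMeetOf m e₁ e₂)
    (E₁ E₂ : H →ₗ.[ℂ] H)
    (hE₁ : Paper.IsComplIdem e₁ e₂ j m E₁) (hE₂ : Paper.IsComplIdem e₂ e₁ j m E₂)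
    (f : H →L[ℂ] H) (hf : Paper.IsProjection M f) (hfj : Paper.rng f ≤ Paper.rng j)
    (r₁ r₂ : H →L[ℂ] H) (hr₁ : Paper.IsSharp E₁ f r₁) (hr₂ : Paper.IsSharp E₂ f r₂)
    (g : H →L[ℂ] H) (hg : Paper.IsMeetOf g (1 - f) m) :
    Paper.rng f ≤
      (Paper.rng r₁ ⊔ Paper.rng r₂ ⊔ Paper.rng (m - g)).topologicalClosure := by
  refine (T.rng_le_closure_inf_sup he₁ he₂ hj hf).trans (Submodule.topologicalClosure_mono ?_)
  rintro x ⟨hxf, hxd⟩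
  have hsup : Paper.rng e₁ ⊔ Paper.rng e₂ ≤ Paper.rng j :=
    hj.2 ▸ Submodule.le_topologicalClosure _
  obtain ⟨y₁, hy₁, y₂, hy₂, rfl⟩ : ∃ y₁ ∈ Paper.rng e₁, ∃ y₂ ∈ Paper.rng e₂, y₁ + y₂ = x := by
    rw [sup_assoc] at hxd
    obtain ⟨_, ⟨z, rfl⟩, y, hy, rfl⟩ := Submodule.mem_sup.1 hxd
    have h1 : j ((1 - j) z + y) = (1 - j) z + y := hj.1.mem_rng_iff.1 (hfj hxf)
    have h2 : j ((1 - j) z) = 0 := by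
      have : j (j z) = j z := congr($(hj.1.1) z)
      simp [this]
    rw [map_add, h2, hj.1.mem_rng_iff.1 (hsup hy), zero_add] at h1
    obtain ⟨y₁, hy₁, y₂, hy₂, h⟩ := Submodule.mem_sup.1 hy
    exact ⟨y₁, hy₁, y₂, hy₂, h.trans h1⟩
  have hz (y : H) : m y ∈ Paper.rng m := ⟨y, rfl⟩
  have hsubmem (e : H →L[ℂ] H) (he : Paper.IsProj e) (y : H) (hy : y ∈ Paper.rng e) :
      y - m y ∈ Paper.rng (e - m) := ⟨y, by
    change e y - m y = _
    rw [he.mem_rng_iff.1 hy]⟩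
  have hξ₁ := hsubmem e₁ he₁.2 y₁ hy₁
  have hξ₂ := hsubmem e₂ he₂.2 y₂ hy₂
  have hsharp (E : H →ₗ.[ℂ] H) (r : H →L[ℂ] H) (hr : Paper.IsSharp E f r) (s t : H)
      (hs : s = y₁ + y₂) (h : ∃ h : s ∈ E.domain, E ⟨s, h⟩ = t) : t ∈ Paper.rng r := by
    obtain ⟨h, rfl⟩ := h
    rw [← SetLike.mem_coe, hr.2]
    exact subset_closure ⟨⟨s, h⟩, hs ▸ hxf, rfl⟩
  have h₁ := hsharp E₁ r₁ hr₁ _ _ (by rw [map_add]; abel)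
    (hE₁.2 0 (y₁ - m y₁) (y₂ - m y₂) (m (y₁ + y₂)) (zero_mem _) hξ₁ hξ₂ (hz _))
  have h₂ := hsharp E₂ r₂ hr₂ _ _ (by rw [map_add]; abel)
    (hE₂.2 0 (y₂ - m y₂) (y₁ - m y₁) (m (y₁ + y₂)) (zero_mem _) hξ₂ hξ₁ (hz _))
  have hg0 : g (y₁ + y₂) = 0 := by
    refine ext_inner_right ℂ fun w => ?_
    have hgw : g w ∈ Paper.rng (1 - f) := (hg.2.le ⟨w, rfl⟩ : g w ∈ _ ⊓ _).1
    have hfg : f (g w) = 0 := by simpa using hf.2.one_sub.mem_rng_iff.1 hgw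
    rw [hg.1.inner_left, ← hf.2.mem_rng_iff.1 hxf, hf.2.inner_left, hfg]
    simp
  have h₃ : m (y₁ + y₂) ∈ Paper.rng (m - g) := ⟨y₁ + y₂, by
    change m (y₁ + y₂) - g (y₁ + y₂) = _
    rw [hg0, sub_zero]⟩
  have hsum : y₁ + y₂ = (y₁ - m y₁ + m (y₁ + y₂)) + (y₂ - m y₂ + m (y₁ + y₂))
      + -m (y₁ + y₂) := by
    rw [map_add]; abel
  rw [hsum]
  exact Submodule.add_mem_sup (Submodule.add_mem_sup h₁ h₂) (neg_mem h₃)
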